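/- There do not exist elements g, h ∈ ℂ(x,y,z) such that the subfield of ℂ(x,y,z) generated over ℂ by x³y + y³ + z², g, and h equals ℂ(x,y,z). That is, the field extension ℂ(x,y,z)/ℂ(e₇) with e₇ = x³y + y³ + z² is not rational. -/

import Mathlib

open MvPolynomial

noncomputable section

/-- The field ℂ(x,y,z): fraction field of the polynomial ring in 3 variables. -/
abbrev Fxyz : Type := FractionRing (MvPolynomial (Fin 3) ℂ)

/-- The images of the variables x, y, z in ℂ(x,y,z). -/
def Vx : Fxyz := algebraMap (MvPolynomial (Fin 3) ℂ) Fxyz (X 0)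
def Vy : Fxyz := algebraMap (MvPolynomial (Fin 3) ℂ) Fxyz (X 1)
def Vz : Fxyz := algebraMap (MvPolynomial (Fin 3) ℂ) Fxyz (X 2)

/-- The norm form `N(a + b θ + c θ²)` of the cubic extension `θ³ = F`. -/
def cubicNorm {R : Type*} [CommRing R] (F a b c : R) : R :=
  a ^ 3 + F * b ^ 3 + F ^ 2 * c ^ 3 - 3 * F * a * b * c

lemma map_cubicNorm {R S : Type*} [CommRing R] [CommRing S] {G : Type*} [FunLike G R S]
    [RingHomClass G R S] (f : G) (F a b c : R) :
    f (cubicNorm F a b c) = cubicNorm (f F) (f a) (f b) (f c) := by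
  simp only [cubicNorm, map_add, map_sub, map_mul, map_pow, map_ofNat]

namespace Polynomial

section Kummer

variable {k : Type*} [Field k] [CharZero k]

/-- An element of `k` which is a cube in `k(∛e)` is, up to cubes of `k`, a power of `e`. -/
lemma exists_eq_pow_mul_cube_of_dvd {e g : k} (he : ∀ b, b ^ 3 ≠ e) {h : k[X]}
    (hd : X ^ 3 - C e ∣ h ^ 3 - C g) :
    ∃ b, g = b ^ 3 ∨ g = e * b ^ 3 ∨ g = e ^ 2 * b ^ 3 := by
  have hm : (X ^ 3 - C e).Monic := monic_X_pow_sub_C e (by norm_num)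
  have hdeg : (X ^ 3 - C e).degree = 3 := degree_X_pow_sub_C (by norm_num) e
  set F := X ^ 3 - C e with hF
  set r := h %ₘ F
  have hr : r.natDegree < 3 := by
    have := natDegree_modByMonic_lt h hm (by
      intro h1; rw [h1] at hdeg; simp at hdeg)
    rwa [natDegree_X_pow_sub_C] at this
  have hrd : F ∣ r ^ 3 - C g := by
    have := dvd_add hd ((dvd_modByMonic_sub h F).trans (sub_dvd_pow_sub_pow r h 3))
    rwa [add_comm, sub_add_sub_cancel] at this
  obtain ⟨h0, h1, h2, hre⟩ : ∃ h0 h1 h2, r = C h0 + C h1 * X + C h2 * X ^ 2 :=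
    ⟨r.coeff 0, r.coeff 1, r.coeff 2, by
      conv_lhs => rw [r.as_sum_range_C_mul_X_pow' hr]
      simp [Finset.sum_range_succ]⟩
  have hz : C (h0 ^ 3 + e * h1 ^ 3 + e ^ 2 * h2 ^ 3 + 6 * e * h0 * h1 * h2 - g)
      + C (3 * (h0 ^ 2 * h1 + e * h0 * h2 ^ 2 + e * h1 ^ 2 * h2)) * X
      + C (3 * (h0 ^ 2 * h2 + h0 * h1 ^ 2 + e * h1 * h2 ^ 2)) * X ^ 2 = 0 := by
    apply eq_zero_of_dvd_of_degree_lt (p := F)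
    · have hq : F ∣ F * (C h1 ^ 3 + 6 * C h0 * C h1 * C h2
          + (3 * C h0 * C h2 ^ 2 + 3 * C h1 ^ 2 * C h2) * X
          + 3 * C h1 * C h2 ^ 2 * X ^ 2 + C h2 ^ 3 * (X ^ 3 + C e)) := dvd_mul_right _ _
      convert dvd_sub hrd hq using 1
      rw [hre, hF]
      have c3 : C (3 : k) = 3 := rfl
      have c6 : C (6 : k) = 6 := rfl
      simp only [map_add, map_sub, map_mul, map_pow, c3, c6]
      ring
    · rw [hdeg]
      refine lt_of_le_of_lt ?_ (by norm_num : (2 : WithBot ℕ) < 3)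
      compute_degree
  have z0 := congrArg (coeff · 0) hz
  have z1 := congrArg (coeff · 1) hz
  have z2 := congrArg (coeff · 2) hz
  simp only [coeff_add, coeff_C_mul, coeff_X_pow, coeff_C, coeff_X, coeff_zero] at z0 z1 z2
  norm_num at z0 z1 z2
  have he0 : e ≠ 0 := fun h => he 0 (by simp [h])
  have key : h0 * (e * h2 ^ 3 - h1 ^ 3) = 0 := by linear_combination h2 * z1 - h1 * z2
  rcases mul_eq_zero.mp key with h | h
  · subst h
    have : h1 ^ 2 * h2 = 0 := by
      refine (mul_eq_zero.mp (?_ : e * (h1 ^ 2 * h2) = 0)).resolve_left he0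
      linear_combination z1
    rcases mul_eq_zero.mp this with h | h
    · have : h1 = 0 := by simpa using h
      subst this
      exact ⟨h2, Or.inr (Or.inr (by linear_combination -z0))⟩
    · subst h
      exact ⟨h1, Or.inr (Or.inl (by linear_combination -z0))⟩
  · have h20 : h2 = 0 := by
      by_contra hne
      refine he (h1 / h2) ?_
      field_simp
      linear_combination -h
    subst h20
    have : h1 = 0 := by simpa using h
    subst this
    exact ⟨h0, Or.inl (by linear_combination -z0)⟩

lemma dvd_of_dvd_mul_cube_sub_cube {e g : k} (he : ∀ b, b ^ 3 ≠ e)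
    (hg : ∀ b, g ≠ b ^ 3 ∧ g ≠ e * b ^ 3 ∧ g ≠ e ^ 2 * b ^ 3) {a b : k[X]}
    (h : X ^ 3 - C e ∣ C g * a ^ 3 - b ^ 3) : X ^ 3 - C e ∣ a ∧ X ^ 3 - C e ∣ b := by
  have hirr : Irreducible (X ^ 3 - C e) :=
    (X_pow_sub_C_irreducible_iff_of_prime Nat.prime_three).mpr he
  have ha : X ^ 3 - C e ∣ a := by
    by_contra hna
    obtain ⟨x, y, hxy⟩ := (hirr.coprime_iff_not_dvd.mpr hna)
    obtain ⟨c, hc⟩ := exists_eq_pow_mul_cube_of_dvd (g := g) he (h := b * y) (by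
      obtain ⟨z, hz⟩ := h
      have h1 : X ^ 3 - C e ∣ (y * a) ^ 3 - 1 ^ 3 :=
        (Dvd.intro (-x) (by linear_combination -hxy)).trans (sub_dvd_pow_sub_pow (y * a) 1 3)
      obtain ⟨w, hw⟩ := h1
      exact ⟨C g * w - z * y ^ 3, by linear_combination C g * hw - y ^ 3 * hz⟩)
    have := hg c
    tauto
  refine ⟨ha, hirr.prime.dvd_of_dvd_pow (n := 3) ?_⟩
  have := dvd_sub (dvd_mul_of_dvd_right (dvd_pow ha three_ne_zero) (C g)) h
  simpa using this

lemma exists_of_mul_cubicNorm_eq {e g : k} (he : ∀ b, b ^ 3 ≠ e)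
    (hg : ∀ b, g ≠ b ^ 3 ∧ g ≠ e * b ^ 3 ∧ g ≠ e ^ 2 * b ^ 3) {a b c a' b' c' : k[X]}
    (h : C g * cubicNorm (X ^ 3 - C e) a b c = cubicNorm (X ^ 3 - C e) a' b' c') :
    ∃ u v w u' v' w', a = (X ^ 3 - C e) * u ∧ b = (X ^ 3 - C e) * v ∧ c = (X ^ 3 - C e) * w ∧
      C g * cubicNorm (X ^ 3 - C e) u v w = cubicNorm (X ^ 3 - C e) u' v' w' := by
  have hF0 : X ^ 3 - C e ≠ 0 := X_pow_sub_C_ne_zero (by norm_num) e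
  have key := @dvd_of_dvd_mul_cube_sub_cube k _ _ e g he hg
  generalize X ^ 3 - C e = F at *
  unfold cubicNorm at *
  obtain ⟨⟨u, rfl⟩, ⟨u', rfl⟩⟩ := key (a := a) (b := a')
    ⟨-(C g * (b ^ 3 + F * c ^ 3 - 3 * a * b * c)) + (b' ^ 3 + F * c' ^ 3 - 3 * a' * b' * c'),
      by linear_combination h⟩
  obtain ⟨⟨v, rfl⟩, ⟨v', rfl⟩⟩ := key (a := b) (b := b')
    ⟨-(C g * (F * u ^ 3 + c ^ 3 - 3 * u * b * c)) + (F * u' ^ 3 + c' ^ 3 - 3 * u' * b' * c'),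
      by apply mul_left_cancel₀ hF0; linear_combination h⟩
  obtain ⟨⟨w, rfl⟩, ⟨w', rfl⟩⟩ := key (a := c) (b := c')
    ⟨-(C g * (u ^ 3 + F * v ^ 3 - 3 * u * v * c)) + (u' ^ 3 + F * v' ^ 3 - 3 * u' * v' * c'),
      by apply mul_left_cancel₀ (pow_ne_zero 2 hF0); linear_combination h⟩
  exact ⟨u, v, w, u', v', w', rfl, rfl, rfl, by
    apply mul_left_cancel₀ (pow_ne_zero 3 hF0); linear_combination h⟩

/-- If `g` is not a cube in `k(∛e)`, then it is not a norm from `k(X)(∛(X³ - e))`. -/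
lemma eq_zero_of_mul_cubicNorm_eq {e g : k} (he : ∀ b, b ^ 3 ≠ e)
    (hg : ∀ b, g ≠ b ^ 3 ∧ g ≠ e * b ^ 3 ∧ g ≠ e ^ 2 * b ^ 3) {a b c a' b' c' : k[X]}
    (h : C g * cubicNorm (X ^ 3 - C e) a b c = cubicNorm (X ^ 3 - C e) a' b' c') :
    a = 0 ∧ b = 0 ∧ c = 0 := by
  have hpow : ∀ n : ℕ, ∀ a b c a' b' c' : k[X],
      C g * cubicNorm (X ^ 3 - C e) a b c = cubicNorm (X ^ 3 - C e) a' b' c' →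
      (X ^ 3 - C e) ^ n ∣ a ∧ (X ^ 3 - C e) ^ n ∣ b ∧ (X ^ 3 - C e) ^ n ∣ c := by
    intro n
    induction n with
    | zero => simp
    | succ n ih =>
      intro a b c a' b' c' h
      obtain ⟨u, v, w, u', v', w', rfl, rfl, rfl, h'⟩ := exists_of_mul_cubicNorm_eq he hg h
      obtain ⟨h1, h2, h3⟩ := ih _ _ _ _ _ _ h'
      rw [pow_succ']
      exact ⟨mul_dvd_mul_left _ h1, mul_dvd_mul_left _ h2, mul_dvd_mul_left _ h3⟩
  have hz : ∀ p : k[X], (∀ n : ℕ, (X ^ 3 - C e) ^ n ∣ p) → p = 0 := by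
    intro p hp
    by_contra h0
    have hirr : Irreducible (X ^ 3 - C e) :=
      (X_pow_sub_C_irreducible_iff_of_prime Nat.prime_three).mpr he
    obtain ⟨n, hn⟩ := FiniteMultiplicity.of_not_isUnit hirr.not_isUnit h0
    exact hn (hp (n + 1))
  exact ⟨hz _ fun n => (hpow n _ _ _ _ _ _ h).1, hz _ fun n => (hpow n _ _ _ _ _ _ h).2.1,
    hz _ fun n => (hpow n _ _ _ _ _ _ h).2.2⟩

end Kummer

section RootMultiplicity

variable {D : Type*} [CommRing D] [IsDomain D]

lemma rootMultiplicity_modEq_of_mul_cube_eq {a b m n : D[X]} (ha : a ≠ 0) (hn : n ≠ 0)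
    (h : a * n ^ 3 = b * m ^ 3) (r : D) :
    rootMultiplicity r a ≡ rootMultiplicity r b [MOD 3] := by
  classical
  have h0 : a * n ^ 3 ≠ 0 := mul_ne_zero ha (pow_ne_zero _ hn)
  have := congrArg (rootMultiplicity r) h
  rw [rootMultiplicity_mul h0, rootMultiplicity_mul (h ▸ h0)] at this
  simp only [← count_roots, roots_pow, Multiset.count_nsmul] at this ⊢
  unfold Nat.ModEq
  omega

end RootMultiplicity

lemma primitive_cube_root_ne {D : Type*} [CommRing D] [CharZero D] {ω : D}
    (hω : ω ^ 2 + ω + 1 = 0) :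
    ω ≠ 1 ∧ ω ^ 2 ≠ 1 ∧ ω ^ 2 ≠ ω := by
  have h3 : (3 : D) ≠ 0 := by exact_mod_cast (by norm_num : (3 : ℕ) ≠ 0)
  refine ⟨?_, ?_, ?_⟩
  · rintro rfl
    exact h3 (by linear_combination hω)
  · intro h
    have : ω = -2 := by linear_combination hω - h
    subst this
    exact h3 (by linear_combination hω)
  · intro h
    exact h3 (by linear_combination (3 - 2 * ω) * hω + (2 * ω + 1) * h)

section CubeClasses

variable {D : Type*} [CommRing D] [IsDomain D] [CharZero D]

/-- For a primitive cube root of unity `ω`, the class of `(T + 1) / (T + ω)` modulo cubes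
of the rational function field is not a power of the class of `-(T³ + 1)`. -/
lemma cube_classes_fractionRing {ω : D} (hω : ω ^ 2 + ω + 1 = 0)
    (K : Type*) [Field K] [Algebra D[X] K] [IsFractionRing D[X] K] :
    (∀ b : K, b ^ 3 ≠ -(algebraMap D[X] K (X ^ 3 + 1))) ∧
    ∀ b : K, algebraMap D[X] K (X + 1) / algebraMap D[X] K (X + C ω) ≠ b ^ 3 ∧
      algebraMap D[X] K (X + 1) / algebraMap D[X] K (X + C ω) ≠
        -(algebraMap D[X] K (X ^ 3 + 1)) * b ^ 3 ∧
      algebraMap D[X] K (X + 1) / algebraMap D[X] K (X + C ω) ≠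
        (-(algebraMap D[X] K (X ^ 3 + 1))) ^ 2 * b ^ 3 := by
  classical
  obtain ⟨n1, n2, n3⟩ := primitive_cube_root_ne hω
  have inj := IsFractionRing.injective D[X] K
  have e1 : (X + 1 : D[X]) = X - C (-1) := by simp
  have e2 : (X + C ω : D[X]) = X - C (-ω) := by simp
  have e3 : (X ^ 3 + 1 : D[X]) = (X - C (-1)) * (X - C (-ω)) * (X - C (-ω ^ 2)) := by
    have hC : (C ω) ^ 2 + C ω + 1 = 0 := by
      rw [← C_pow, ← C_add, ← C_1, ← C_add, hω, C_0]
    simp only [map_neg, map_pow, C_1]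
    linear_combination (-X ^ 2 - C ω * X + 1 - C ω) * hC
  have hne : ∀ r : D, (X - C r : D[X]) ≠ 0 := X_sub_C_ne_zero
  have h2K : algebraMap D[X] K (X - C (-ω)) ≠ 0 := by
    rw [Ne, map_eq_zero_iff _ inj]; exact hne _
  rw [e1, e2, e3]
  have rm1 : ∀ x a : D, rootMultiplicity x (X - C a) = if x = a then 1 else 0 :=
    fun x a => rootMultiplicity_X_sub_C
  have hnum : ∀ b : K, ∃ m n : D[X], n ≠ 0 ∧ algebraMap D[X] K n ≠ 0 ∧
      b = algebraMap D[X] K m / algebraMap D[X] K n := by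
    intro b
    obtain ⟨m, n, hn, rfl⟩ := IsFractionRing.div_surjective (A := D[X]) b
    have hn0 := nonZeroDivisors.ne_zero hn
    exact ⟨m, n, hn0, by rwa [Ne, map_eq_zero_iff _ inj], rfl⟩
  refine ⟨fun b hb => ?_, fun b => ⟨fun hb => ?_, fun hb => ?_, fun hb => ?_⟩⟩
  all_goals obtain ⟨m, n, hn, hnK, rfl⟩ := hnum b
  · have h : ((X - C (-1)) * (X - C (-ω)) * (X - C (-ω ^ 2))) * n ^ 3 = 1 * (-m) ^ 3 := by
      apply inj
      field_simp at hb
      simp only [map_mul, map_pow, map_neg, map_one] at hb ⊢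
      linear_combination hb
    have := rootMultiplicity_modEq_of_mul_cube_eq
      (mul_ne_zero (mul_ne_zero (hne _) (hne _)) (hne _)) hn h (-1)
    rw [rootMultiplicity_mul (mul_ne_zero (mul_ne_zero (hne _) (hne _)) (hne _)),
      rootMultiplicity_mul (mul_ne_zero (hne _) (hne _)), rm1, rm1, rm1,
      rootMultiplicity_eq_zero (p := 1) (by simp)] at this
    simp [n1.symm, n2.symm, Nat.ModEq] at this
  · have h : (X - C (-1)) * n ^ 3 = (X - C (-ω)) * m ^ 3 := by
      apply inj
      field_simp at hb
      simp only [map_mul, map_pow] at hb ⊢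
      linear_combination hb
    have := rootMultiplicity_modEq_of_mul_cube_eq (hne _) hn h (-1)
    rw [rm1, rm1] at this
    simp [n1.symm, Nat.ModEq] at this
  · have h : (X - C (-1)) * n ^ 3 =
        (X - C (-ω)) * ((X - C (-1)) * (X - C (-ω)) * (X - C (-ω ^ 2))) * (-m) ^ 3 := by
      apply inj
      field_simp at hb
      simp only [map_mul, map_pow, map_neg] at hb ⊢
      linear_combination hb
    have := rootMultiplicity_modEq_of_mul_cube_eq (hne _) hn h (-ω ^ 2)
    rw [rootMultiplicity_mul
        (mul_ne_zero (hne _) (mul_ne_zero (mul_ne_zero (hne _) (hne _)) (hne _))),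
      rootMultiplicity_mul (mul_ne_zero (mul_ne_zero (hne _) (hne _)) (hne _)),
      rootMultiplicity_mul (mul_ne_zero (hne _) (hne _)), rm1, rm1, rm1] at this
    simp [n2, n3, Nat.ModEq] at this
  · have h : (X - C (-1)) * n ^ 3 =
        (X - C (-ω)) * ((X - C (-1)) * (X - C (-ω)) * (X - C (-ω ^ 2))) *
          ((X - C (-1)) * (X - C (-ω)) * (X - C (-ω ^ 2))) * m ^ 3 := by
      apply inj
      field_simp at hb
      simp only [map_mul, map_pow] at hb ⊢
      linear_combination hb
    have := rootMultiplicity_modEq_of_mul_cube_eq (hne _) hn h (-ω ^ 2)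
    have h4 := mul_ne_zero (mul_ne_zero (hne (-1)) (hne (-ω))) (hne (-ω ^ 2))
    rw [rootMultiplicity_mul (mul_ne_zero (mul_ne_zero (hne _) h4) h4),
      rootMultiplicity_mul (mul_ne_zero (hne _) h4),
      rootMultiplicity_mul h4,
      rootMultiplicity_mul (mul_ne_zero (hne _) (hne _)), rm1, rm1, rm1] at this
    simp [n2, n3, Nat.ModEq] at this

/-- `(T + 1) / (T + ω)` is not a norm for the extension of the rational function field in `S, T`
obtained by adjoining a cube root of `S³ + T³ + 1`. -/
lemma eq_zero_of_mul_cubicNorm_fermat_eq {ω : D} (hω : ω ^ 2 + ω + 1 = 0)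
    {a b c a' b' c' : D[X][X]}
    (h : C (X + 1) * cubicNorm (X ^ 3 + C (X ^ 3 + 1)) a b c =
      C (X + C ω) * cubicNorm (X ^ 3 + C (X ^ 3 + 1)) a' b' c') :
    a = 0 ∧ b = 0 ∧ c = 0 := by
  let K := FractionRing D[X]
  have inj := IsFractionRing.injective D[X] K
  have : CharZero K := charZero_of_injective_algebraMap inj
  obtain ⟨he, hg⟩ := cube_classes_fractionRing hω K
  have hinj : Function.Injective (mapRingHom (algebraMap D[X] K)) := map_injective _ inj
  have hz : algebraMap D[X] K (X + C ω) ≠ 0 := by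
    rw [Ne, map_eq_zero_iff _ inj]; exact X_add_C_ne_zero _
  have h' := congrArg (mapRingHom (algebraMap D[X] K)) h
  have hF : mapRingHom (algebraMap D[X] K) (X ^ 3 + C (X ^ 3 + 1)) =
      X ^ 3 - C (-(algebraMap D[X] K (X ^ 3 + 1))) := by
    simp
    ring
  rw [map_mul, map_mul, map_cubicNorm, map_cubicNorm, hF] at h'
  simp only [coe_mapRingHom, map_C] at h'
  have := eq_zero_of_mul_cubicNorm_eq he hg (a := map (algebraMap D[X] K) a)
    (b := map (algebraMap D[X] K) b) (c := map (algebraMap D[X] K) c)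
    (a' := map (algebraMap D[X] K) a')
    (b' := map (algebraMap D[X] K) b') (c' := map (algebraMap D[X] K) c') (by
      have hC : C (algebraMap D[X] K (X + C ω)) ≠ 0 := C_ne_zero.mpr hz
      apply mul_left_cancel₀ hC
      rw [← h', ← mul_assoc, ← C_mul, mul_div_cancel₀ _ hz])
  simpa only [Polynomial.map_eq_zero_iff inj] using this

end CubeClasses

end Polynomial

section TwistedNorm

variable {R : Type*} [CommRing R] (σ : R ≃+* R)

/-- The product of `x` with its images under `σ` and `σ²`. -/
def orderThreeNorm (x : R) : R := x * σ x * σ (σ x)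

lemma orderThreeNorm_mul (x y : R) :
    orderThreeNorm σ (x * y) = orderThreeNorm σ x * orderThreeNorm σ y := by
  simp only [orderThreeNorm, map_mul]
  ring

variable {σ}

lemma map_orderThreeNorm (hσ : ∀ x, σ (σ (σ x)) = x) (x : R) :
    σ (orderThreeNorm σ x) = orderThreeNorm σ x := by
  simp only [orderThreeNorm, map_mul, hσ]
  ring

lemma multiplicity_map_of_associated {ρ : R} (h : Associated (σ ρ) ρ) (x : R) :
    multiplicity ρ (σ x) = multiplicity ρ x := by
  rw [← multiplicity_map_eq σ (a := ρ) (b := x)]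
  exact multiplicity_eq_of_associated_left h

variable [IsDomain R]

lemma orderThreeNorm_ne_zero {x : R} (hx : x ≠ 0) : orderThreeNorm σ x ≠ 0 := by
  simp [orderThreeNorm, hx]

variable [UniqueFactorizationMonoid R]

lemma multiplicity_mul_of_prime {ρ a b : R} (hρ : Prime ρ) (ha : a ≠ 0) (hb : b ≠ 0) :
    multiplicity ρ (a * b) = multiplicity ρ a + multiplicity ρ b :=
  multiplicity_mul hρ (FiniteMultiplicity.of_prime_left hρ (mul_ne_zero ha hb))

lemma multiplicity_orderThreeNorm {ρ : R} (hρ : Prime ρ) (h : Associated (σ ρ) ρ)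
    {x : R} (hx : x ≠ 0) :
    multiplicity ρ (orderThreeNorm σ x) = 3 * multiplicity ρ x := by
  have h1 : σ x ≠ 0 := by simpa using hx
  have h2 : σ (σ x) ≠ 0 := by simpa using hx
  rw [orderThreeNorm, multiplicity_mul_of_prime hρ (mul_ne_zero hx h1) h2,
    multiplicity_mul_of_prime hρ hx h1, multiplicity_map_of_associated h,
    multiplicity_map_of_associated h, multiplicity_map_of_associated h]
  ring

/-- A `σ`-invariant element of a factorial ring is a norm, provided that its multiplicity at
every `σ`-stable prime is divisible by three and invariant units are norms. -/
lemma exists_orderThreeNorm_eq (hσ : ∀ x, σ (σ (σ x)) = x)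
    (hu : ∀ u : R, IsUnit u → σ u = u → ∃ v, orderThreeNorm σ v = u) (G : R) (hG : G ≠ 0)
    (hfix : σ G = G)
    (hmul : ∀ ρ, Prime ρ → Associated (σ ρ) ρ → 3 ∣ multiplicity ρ G) :
    ∃ q, orderThreeNorm σ q = G := by
  induction G using (wellFounded_dvdNotUnit (α := R)).induction with
  | _ G ih =>
  by_cases hGu : IsUnit G
  · exact hu G hGu hfix
  obtain ⟨π, hπirr, hπG⟩ := WfDvdMonoid.exists_irreducible_factor hGu hG
  have hπ : Prime π := hπirr.prime
  have hdvd : orderThreeNorm σ π ∣ G := by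
    have hσπ : Prime (σ π) := (MulEquiv.prime_iff σ).mpr hπ
    have hσσπ : Prime (σ (σ π)) := (MulEquiv.prime_iff σ).mpr hσπ
    have d1 : σ π ∣ G := hfix ▸ map_dvd σ hπG
    have d2 : σ (σ π) ∣ G := hfix ▸ map_dvd σ d1
    by_cases hst : Associated (σ π) π
    · have h3 : π ^ 3 ∣ G := by
        refine pow_dvd_of_le_multiplicity ?_
        have h1 : 1 ≤ multiplicity π G := by
          have := (FiniteMultiplicity.of_prime_left hπ hG).le_multiplicity_of_pow_dvd (k := 1)
          exact this (by simpa using hπG)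
        exact Nat.le_of_dvd h1 (hmul π hπ hst)
      refine dvd_trans ?_ h3
      have hst2 : Associated (σ (σ π)) π := (hst.map σ).trans hst
      have := (((Associated.refl π).mul_mul hst).mul_mul hst2).dvd
      rwa [← pow_three'] at this
    · have n1 : ¬ π ∣ σ π := fun h => hst ((hπirr.associated_of_dvd hσπ.irreducible h).symm)
      have n2 : ¬ σ π ∣ σ (σ π) := fun h => n1 ((map_dvd_iff σ).mp h)
      have n3 : ¬ π ∣ σ (σ π) := fun h => by
        have := hπirr.associated_of_dvd hσσπ.irreducible h
        have := this.map σ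
        rw [hσ] at this
        exact hst this
      have e1 : π * σ π ∣ G := by
        obtain ⟨c, rfl⟩ := d1
        have := (hπ.dvd_mul.mp hπG).resolve_left n1
        rw [mul_comm]
        exact mul_dvd_mul_left _ this
      obtain ⟨c, hc⟩ := e1
      rw [hc] at d2 ⊢
      refine mul_dvd_mul_left _ ((hσσπ.dvd_mul.mp d2).resolve_left fun h => ?_)
      rcases hσσπ.dvd_mul.mp h with h | h
      · exact n3 (hσσπ.irreducible.associated_of_dvd hπirr h).symm.dvd
      · exact n2 (hσσπ.irreducible.associated_of_dvd hσπ.irreducible h).symm.dvd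
  obtain ⟨H, rfl⟩ := hdvd
  have hH : H ≠ 0 := right_ne_zero_of_mul hG
  have hN := orderThreeNorm_ne_zero (σ := σ) hπ.ne_zero
  obtain ⟨q, rfl⟩ := ih H ⟨hH, orderThreeNorm σ π, fun h =>
      hπ.not_isUnit (isUnit_of_mul_isUnit_left (isUnit_of_mul_isUnit_left h)), mul_comm _ _⟩ hH
    (by
      rw [map_mul, map_orderThreeNorm hσ] at hfix
      exact mul_left_cancel₀ hN hfix)
    (fun ρ hρ hst => by
      have := hmul ρ hρ hst
      rw [multiplicity_mul_of_prime hρ hN hH,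
        multiplicity_orderThreeNorm hρ hst hπ.ne_zero] at this
      omega)
  exact ⟨π * q, orderThreeNorm_mul σ π q⟩

/-- If three nonzero elements sum to zero and the sum of their multiplicities is divisible by
three, then their multiplicities are congruent modulo three. -/
lemma three_dvd_multiplicity_add_two_mul {ρ e₁ e₂ e₃ : R} (hρ : Prime ρ)
    (h1 : e₁ ≠ 0) (h2 : e₂ ≠ 0) (h3 : e₃ ≠ 0)
    (hsum : e₁ + e₂ + e₃ = 0)
    (hd : 3 ∣ multiplicity ρ e₁ + multiplicity ρ e₂ + multiplicity ρ e₃) :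
    3 ∣ multiplicity ρ e₁ + 2 * multiplicity ρ e₂ := by
  have key : ∀ a b c : R, a ≠ 0 → b ≠ 0 → c ≠ 0 → a + b + c = 0 →
      min (multiplicity ρ a) (multiplicity ρ b) ≤ multiplicity ρ c := by
    intro a b c ha hb hc h
    refine (FiniteMultiplicity.of_prime_left hρ hc).le_multiplicity_of_pow_dvd ?_
    have hc' : c = -(a + b) := by linear_combination h
    rw [hc', dvd_neg]
    exact dvd_add (pow_dvd_of_le_multiplicity (min_le_left _ _))
      (pow_dvd_of_le_multiplicity (min_le_right _ _))
  have k1 := key _ _ _ h1 h2 h3 hsum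
  have k2 := key _ _ _ h2 h3 h1 (by linear_combination hsum)
  have k3 := key _ _ _ h3 h1 h2 (by linear_combination hsum)
  omega

end TwistedNorm

lemma map_orderThreeNorm_eq {R K : Type*} [CommRing R] [CommRing K] [Algebra R K]
    {σ : R ≃+* R} {τ : K ≃+* K}
    (hτ : ∀ x, τ (algebraMap R K x) = algebraMap R K (σ x)) (x : R) :
    algebraMap R K (orderThreeNorm σ x) = orderThreeNorm τ (algebraMap R K x) := by
  simp [orderThreeNorm, hτ]

/-- If `A³ + 1` is a norm for an automorphism of order three of the fraction field of a factorial
ring, then so is `(A + 1) / (A + ω)`. -/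
lemma exists_mul_orderThreeNorm_eq {R K : Type*} [CommRing R] [IsDomain R]
    [UniqueFactorizationMonoid R] [Field K] [Algebra R K] [IsFractionRing R K]
    {σ : R ≃+* R} {τ : K ≃+* K}
    (hτ : ∀ x, τ (algebraMap R K x) = algebraMap R K (σ x))
    (hσ : ∀ x, σ (σ (σ x)) = x)
    (hu : ∀ u : R, IsUnit u → σ u = u → ∃ v, orderThreeNorm σ v = u)
    {ω : R} (hω : ω ^ 2 + ω + 1 = 0) (hσω : σ ω = ω) {A β : K} (hA : τ A = A)
    (hβ : orderThreeNorm τ β = A ^ 3 + 1) (hA0 : A ^ 3 + 1 ≠ 0) :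
    ∃ p q : R, p ≠ 0 ∧ (A + 1) * orderThreeNorm τ (algebraMap R K p) =
      (A + algebraMap R K ω) * orderThreeNorm τ (algebraMap R K q) := by
  have inj := IsFractionRing.injective R K
  obtain ⟨α, δ, hδ, rfl⟩ := IsFractionRing.div_surjective (A := R) A
  obtain ⟨b, ε, hε, rfl⟩ := IsFractionRing.div_surjective (A := R) β
  have hδ0 : δ ≠ 0 := nonZeroDivisors.ne_zero hδ
  have hε0 : ε ≠ 0 := nonZeroDivisors.ne_zero hε
  have hδK : algebraMap R K δ ≠ 0 := by rwa [Ne, map_eq_zero_iff _ inj]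
  have hεN := orderThreeNorm_ne_zero (σ := σ) hε0
  have hεK : algebraMap R K (orderThreeNorm σ ε) ≠ 0 := by rwa [Ne, map_eq_zero_iff _ inj]
  have hω3 : ω ^ 3 = 1 := by linear_combination (ω - 1) * hω
  have hωu : IsUnit ω := IsUnit.of_mul_eq_one (ω ^ 2) (by linear_combination hω3)
  have hcube : (α + δ) * (α + ω * δ) * (α + ω ^ 2 * δ) = α ^ 3 + δ ^ 3 := by
    linear_combination (α ^ 2 * δ + ω * α * δ ^ 2) * hω + δ ^ 3 * hω3
  have hprod : orderThreeNorm σ b * δ ^ 3 =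
      orderThreeNorm σ ε * ((α + δ) * (α + ω * δ) * (α + ω ^ 2 * δ)) := by
    rw [hcube]
    apply inj
    have hdiv : orderThreeNorm τ (algebraMap R K b / algebraMap R K ε) =
        algebraMap R K (orderThreeNorm σ b) / algebraMap R K (orderThreeNorm σ ε) := by
      rw [map_orderThreeNorm_eq hτ, map_orderThreeNorm_eq hτ]
      simp only [orderThreeNorm, map_div₀]
      ring
    rw [hdiv] at hβ
    field_simp at hβ
    simp only [map_mul, map_pow, map_add]
    exact hβ
  have hne : (α + δ) * (α + ω * δ) * (α + ω ^ 2 * δ) ≠ 0 := by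
    intro h
    apply hA0
    rw [hcube] at h
    rw [div_pow, div_add_one (pow_ne_zero 3 hδK), ← map_pow, ← map_pow, ← map_add, h, map_zero,
      zero_div]
  have h1 : α + δ ≠ 0 := left_ne_zero_of_mul (left_ne_zero_of_mul hne)
  have h2 : α + ω * δ ≠ 0 := right_ne_zero_of_mul (left_ne_zero_of_mul hne)
  have h3 : α + ω ^ 2 * δ ≠ 0 := right_ne_zero_of_mul hne
  have hb : orderThreeNorm σ b ≠ 0 := by
    intro h
    rw [h, zero_mul] at hprod
    exact mul_ne_zero hεN hne hprod.symm
  have hb0 : b ≠ 0 := by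
    rintro rfl
    simp [orderThreeNorm] at hb
  have hσ2 : σ (α + ω * δ) ≠ 0 := by simpa only [Ne, map_eq_zero_iff σ σ.injective] using h2
  have hσσ2 : σ (σ (α + ω * δ)) ≠ 0 := by
    simpa only [Ne, map_eq_zero_iff σ σ.injective] using h2
  have hσα : σ α * δ = α * σ δ := by
    have hσδK : algebraMap R K (σ δ) ≠ 0 := by
      rw [Ne, map_eq_zero_iff _ inj, map_eq_zero_iff σ σ.injective]; exact hδ0
    apply inj
    rw [map_div₀, hτ, hτ] at hA
    field_simp at hA
    simp only [map_mul]
    linear_combination hA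
  have hfix : σ ((α + δ) * σ (α + ω * δ) * σ (σ (α + ω * δ))) =
      (α + δ) * σ (α + ω * δ) * σ (σ (α + ω * δ)) := by
    simp only [map_mul σ (_ * _), map_mul σ (α + δ), hσ]
    have : σ (α + δ) * (α + ω * δ) = (α + δ) * σ (α + ω * δ) := by
      simp only [map_add, map_mul, hσω]
      linear_combination (ω - 1) * hσα
    linear_combination σ (σ (α + ω * δ)) * this
  obtain ⟨q, hq⟩ := exists_orderThreeNorm_eq hσ hu
    ((α + δ) * σ (α + ω * δ) * σ (σ (α + ω * δ)))
    (mul_ne_zero (mul_ne_zero h1 hσ2) hσσ2) hfix (by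
      intro ρ hρ hst
      rw [multiplicity_mul_of_prime hρ (mul_ne_zero h1 hσ2) hσσ2,
        multiplicity_mul_of_prime hρ h1 hσ2, multiplicity_map_of_associated hst,
        multiplicity_map_of_associated hst, multiplicity_map_of_associated hst]
      have hm := congrArg (multiplicity ρ) hprod
      rw [multiplicity_mul_of_prime hρ hb (pow_ne_zero 3 hδ0),
        multiplicity_mul_of_prime hρ hεN hne,
        multiplicity_mul_of_prime hρ (mul_ne_zero h1 h2) h3,
        multiplicity_mul_of_prime hρ h1 h2, multiplicity_orderThreeNorm hρ hst hb0,
        multiplicity_orderThreeNorm hρ hst hε0,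
        (FiniteMultiplicity.of_prime_left hρ hδ0).multiplicity_pow hρ] at hm
      have m2 : multiplicity ρ (ω * (α + ω * δ)) = multiplicity ρ (α + ω * δ) :=
        multiplicity_eq_of_associated_right (associated_unit_mul_left _ _ hωu)
      have m3 : multiplicity ρ (ω ^ 2 * (α + ω ^ 2 * δ)) = multiplicity ρ (α + ω ^ 2 * δ) :=
        multiplicity_eq_of_associated_right (associated_unit_mul_left _ _ (hωu.pow 2))
      have := three_dvd_multiplicity_add_two_mul hρ h1 (mul_ne_zero hωu.ne_zero h2)
        (mul_ne_zero (pow_ne_zero 2 hωu.ne_zero) h3)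
        (by linear_combination (α + δ) * hω + δ * ω * hω3) (by rw [m2, m3]; omega)
      rw [m2] at this
      omega)
  refine ⟨α + ω * δ, q, h2, ?_⟩
  rw [← map_orderThreeNorm_eq hτ, ← map_orderThreeNorm_eq hτ, hq]
  field_simp
  simp only [orderThreeNorm, map_mul, map_add]
  ring

lemma trdeg_fractionRing_mvPolynomial :
    Algebra.trdeg ℂ Fxyz = 3 := by
  have : Algebra.IsAlgebraic (MvPolynomial (Fin 3) ℂ) Fxyz :=
    IsLocalization.isAlgebraic _ (nonZeroDivisors (MvPolynomial (Fin 3) ℂ))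
  have h := (IsTranscendenceBasis.mvPolynomial (Fin 3) ℂ).algebraMap_comp (A := Fxyz)
  simpa using h.lift_cardinalMk_eq_trdeg.symm

open scoped IntermediateField.algebraAdjoinAdjoin in
/-- Three rational functions are algebraically independent as soon as the only root-closed
intermediate field containing them is the whole field. -/
lemma algebraicIndependent_of_forall_eq_top (v : Fin 3 → Fxyz)
    (H : ∀ E : IntermediateField ℂ Fxyz, (∀ i, v i ∈ E) →
      (∀ (m : Fxyz) (n : ℕ), 0 < n → m ^ n ∈ E → m ∈ E) → E = ⊤) :
    AlgebraicIndependent ℂ v := by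
  let k := IntermediateField.adjoin ℂ (Set.range v)
  have htop := H ((algebraicClosure k Fxyz).restrictScalars ℂ)
    (fun i ↦ by
      rw [IntermediateField.mem_restrictScalars, mem_algebraicClosure_iff]
      exact isAlgebraic_algebraMap
        (⟨v i, IntermediateField.subset_adjoin ℂ _ ⟨i, rfl⟩⟩ : k))
    (fun m n hn h ↦ by
      rw [IntermediateField.mem_restrictScalars, mem_algebraicClosure_iff] at h ⊢
      exact h.of_pow hn)
  have halg : Algebra.IsAlgebraic k Fxyz := ⟨fun x ↦ by
    have : x ∈ (algebraicClosure k Fxyz).restrictScalars ℂ := htop ▸ trivial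
    rwa [IntermediateField.mem_restrictScalars, mem_algebraicClosure_iff] at this⟩
  have : Algebra.IsAlgebraic (Algebra.adjoin ℂ (Set.range v)) Fxyz :=
    (IsFractionRing.comap_isAlgebraic_iff (K := k)).mpr halg
  exact (Algebra.IsAlgebraic.isTranscendenceBasis_of_le_trdeg_of_finite ℂ v
    (by simp [trdeg_fractionRing_mvPolynomial])).1

lemma adjoin_variables_eq_top : IntermediateField.adjoin ℂ {Vx, Vy, Vz} = ⊤ := by
  rw [eq_top_iff]
  intro m _
  obtain ⟨p, q, _, rfl⟩ := IsFractionRing.div_surjective (A := MvPolynomial (Fin 3) ℂ) m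
  have key : ∀ p : MvPolynomial (Fin 3) ℂ,
      algebraMap _ Fxyz p ∈ IntermediateField.adjoin ℂ {Vx, Vy, Vz} := by
    intro p
    induction p using MvPolynomial.induction_on with
    | C a =>
      rw [← MvPolynomial.algebraMap_eq, ← IsScalarTower.algebraMap_apply]
      exact IntermediateField.algebraMap_mem _ a
    | add p q hp hq => rw [map_add]; exact add_mem hp hq
    | mul_X p i hp =>
      rw [map_mul]
      refine mul_mem hp (IntermediateField.subset_adjoin ℂ _ ?_)
      fin_cases i
      · exact Or.inl rfl
      · exact Or.inr (Or.inl rfl)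
      · exact Or.inr (Or.inr rfl)
  exact div_mem (key p) (key q)

lemma algebraicIndependent_of_adjoin_eq_top {f g h : Fxyz}
    (hfgh : IntermediateField.adjoin ℂ {f, g, h} = ⊤) : AlgebraicIndependent ℂ ![f, g, h] := by
  refine algebraicIndependent_of_forall_eq_top _ fun E hE _ ↦ ?_
  rw [eq_top_iff, ← hfgh, IntermediateField.adjoin_le_iff]
  rintro x (rfl | rfl | rfl)
  · exact hE 0
  · exact hE 1
  · exact hE 2

lemma exists_algHom_of_algebraicIndependent {v : Fin 3 → Fxyz} (hv : AlgebraicIndependent ℂ v) :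
    ∃ φ : Fxyz →ₐ[ℂ] Fxyz, ∀ i, φ (algebraMap (MvPolynomial (Fin 3) ℂ) Fxyz (X i)) = v i := by
  have hinj : Function.Injective (aeval v : MvPolynomial (Fin 3) ℂ →ₐ[ℂ] Fxyz) := hv
  refine ⟨IsFractionRing.liftAlgHom hinj, fun i ↦ ?_⟩
  rw [IsFractionRing.coe_liftAlgHom, IsFractionRing.lift_algebraMap]
  exact aeval_X v i

/-- Generators of `ℂ(x, y, z)` can be sent to arbitrary algebraically independent elements. -/
lemma exists_algHom_of_adjoin_eq_top {f g h f' g' h' : Fxyz}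
    (hfgh : IntermediateField.adjoin ℂ {f, g, h} = ⊤)
    (hi : AlgebraicIndependent ℂ ![f', g', h']) :
    ∃ φ : Fxyz →ₐ[ℂ] Fxyz, φ f = f' ∧ φ g = g' ∧ φ h = h' := by
  obtain ⟨θ, hθ⟩ := exists_algHom_of_algebraicIndependent
    (algebraicIndependent_of_adjoin_eq_top hfgh)
  obtain ⟨κ, hκ⟩ := exists_algHom_of_algebraicIndependent hi
  have hsurj : Function.Surjective θ := by
    rw [← AlgHom.fieldRange_eq_top, eq_top_iff, ← hfgh, IntermediateField.adjoin_le_iff]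
    rintro x (rfl | rfl | rfl)
    · exact ⟨_, hθ 0⟩
    · exact ⟨_, hθ 1⟩
    · exact ⟨_, hθ 2⟩
  let e := AlgEquiv.ofBijective θ ⟨θ.toRingHom.injective, hsurj⟩
  have he : ∀ i, e.symm (![f, g, h] i) = algebraMap (MvPolynomial (Fin 3) ℂ) Fxyz (X i) :=
    fun i ↦ e.symm_apply_eq.mpr (hθ i).symm
  refine ⟨κ.comp e.symm, ?_, ?_, ?_⟩
  · exact (congrArg κ (he 0)).trans (hκ 0)
  · exact (congrArg κ (he 1)).trans (hκ 1)
  · exact (congrArg κ (he 2)).trans (hκ 2)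

lemma algHom_ext_of_adjoin_eq_top {f g h : Fxyz}
    (hfgh : IntermediateField.adjoin ℂ {f, g, h} = ⊤) {φ ψ : Fxyz →ₐ[ℂ] Fxyz}
    (hf : φ f = ψ f) (hg : φ g = ψ g) (hh : φ h = ψ h) : φ = ψ := by
  refine DFunLike.ext _ _ fun x ↦ ?_
  have hx : x ∈ IntermediateField.adjoin ℂ {f, g, h} := hfgh ▸ trivial
  induction hx using IntermediateField.adjoin_induction with
  | mem x hx => obtain rfl | rfl | rfl := hx <;> assumption
  | algebraMap x => simp only [AlgHom.commutes]
  | add x y _ _ hx hy => simp only [map_add, hx, hy]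
  | inv x _ hx => simp only [map_inv₀, hx]
  | mul x y _ _ hx hy => simp only [map_mul, hx, hy]

lemma algebraicIndependent_pow_variable {n : ℕ} (hn : 0 < n) :
    AlgebraicIndependent ℂ ![Vx ^ n, Vy, Vz] := by
  refine algebraicIndependent_of_forall_eq_top _ fun E hE hroot ↦ ?_
  rw [eq_top_iff, ← adjoin_variables_eq_top, IntermediateField.adjoin_le_iff]
  rintro x (rfl | rfl | rfl)
  · exact hroot _ n hn (hE 0)
  · exact hE 1
  · exact hE 2

/-- Multiplication of the first variable by a cube root of unity. -/
lemma exists_automorphism_of_cube_eq_one {ω : ℂ} (hω : ω ^ 3 = 1) :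
    ∃ (σ : MvPolynomial (Fin 3) ℂ ≃ₐ[ℂ] MvPolynomial (Fin 3) ℂ) (τ : Fxyz ≃ₐ[ℂ] Fxyz),
      (∀ p, τ (algebraMap _ Fxyz p) = algebraMap _ Fxyz (σ p)) ∧ (∀ p, σ (σ (σ p)) = p) ∧
      τ Vx = algebraMap ℂ Fxyz ω * Vx ∧ τ Vy = Vy ∧ τ Vz = Vz := by
  obtain ⟨s, h0, h1, h2⟩ : ∃ s : MvPolynomial (Fin 3) ℂ →ₐ[ℂ] MvPolynomial (Fin 3) ℂ,
      s (X 0) = C ω * X 0 ∧ s (X 1) = X 1 ∧ s (X 2) = X 2 :=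
    ⟨aeval ![C ω * X 0, X 1, X 2], aeval_X _ 0, aeval_X _ 1, aeval_X _ 2⟩
  have hsC : s (C ω) = C ω := s.commutes ω
  have hC : (C ω * (C ω * C ω) : MvPolynomial (Fin 3) ℂ) = 1 := by
    rw [← C_mul, ← C_mul, ← C_1, ← hω]
    congr 1
    ring
  have hs : s.comp (s.comp s) = AlgHom.id ℂ _ := by
    refine MvPolynomial.algHom_ext fun i ↦ ?_
    fin_cases i
    · change s (s (s (X 0))) = X 0
      simp only [map_mul, hsC, h0]
      linear_combination X 0 * hC
    · change s (s (s (X 1))) = X 1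
      simp only [h1]
    · change s (s (s (X 2))) = X 2
      simp only [h2]
  let σ := AlgEquiv.ofAlgHom s (s.comp s) hs hs
  let τ := IsFractionRing.fieldEquivOfAlgEquiv ℂ Fxyz Fxyz σ
  have hτ : ∀ p, τ (algebraMap _ Fxyz p) = algebraMap _ Fxyz (σ p) :=
    IsFractionRing.fieldEquivOfAlgEquiv_algebraMap ℂ Fxyz Fxyz σ
  refine ⟨σ, τ, hτ, fun p ↦ DFunLike.congr_fun hs p, ?_, ?_, ?_⟩
  · rw [Vx, hτ, show σ (X 0) = C ω * X 0 from h0, map_mul, ← MvPolynomial.algebraMap_eq,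
      ← IsScalarTower.algebraMap_apply]
  · rw [Vy, hτ, show σ (X 1) = X 1 from h1]
  · rw [Vz, hτ, show σ (X 2) = X 2 from h2]

lemma MvPolynomial.exists_ringEquiv_polynomial_polynomial (ω : ℂ) :
    ∃ e : MvPolynomial (Fin 3) ℂ ≃+* Polynomial (Polynomial (MvPolynomial (Fin 1) ℂ)),
      e (X 0) = Polynomial.X ∧ e (X 1) = Polynomial.C Polynomial.X ∧
      e (C ω) = Polynomial.C (Polynomial.C (C ω)) := by
  refine ⟨(finSuccEquiv ℂ 2).toRingEquiv.trans
    (Polynomial.mapEquiv (finSuccEquiv ℂ 1).toRingEquiv), ?_, ?_, ?_⟩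
  · simp [finSuccEquiv_X_zero]
  · have : (X 1 : MvPolynomial (Fin 3) ℂ) = X (Fin.succ 0) := rfl
    simp [this, finSuccEquiv_X_succ, finSuccEquiv_X_zero]
  · simp [finSuccEquiv_apply]

lemma MvPolynomial.eq_zero_of_mul_cubicNorm_fermat_eq {ω : ℂ} (hω : ω ^ 2 + ω + 1 = 0)
    {a b c a' b' c' : MvPolynomial (Fin 3) ℂ}
    (h : (X 1 + 1) * cubicNorm (X 0 ^ 3 + X 1 ^ 3 + 1) a b c =
      (X 1 + C ω) * cubicNorm (X 0 ^ 3 + X 1 ^ 3 + 1) a' b' c') :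
    a = 0 ∧ b = 0 ∧ c = 0 := by
  obtain ⟨e, h0, h1, hc⟩ := exists_ringEquiv_polynomial_polynomial ω
  have hω' : (C ω : MvPolynomial (Fin 1) ℂ) ^ 2 + C ω + 1 = 0 := by
    rw [← C_pow, ← C_1, ← C_add, ← C_add, hω, C_0]
  have h' := congrArg e h
  simp only [map_mul, map_cubicNorm, map_add, map_pow, map_one, h0, h1, hc] at h'
  have key := Polynomial.eq_zero_of_mul_cubicNorm_fermat_eq hω' (a := e a) (b := e b) (c := e c)
    (a' := e a') (b' := e b') (c' := e c') (by
      simpa only [map_add, map_pow, map_one, add_assoc] using h')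
  simpa using key

lemma orderThreeNorm_eq_cubicNorm {K : Type*} [Field K] {τ : K ≃+* K} {ξ η a b c : K}
    (hη : η ^ 2 + η + 1 = 0) (hτη : τ η = η) (hξ : τ ξ = η * ξ) (ha : τ a = a) (hb : τ b = b)
    (hc : τ c = c) :
    orderThreeNorm τ (a + b * ξ + c * ξ ^ 2) = cubicNorm (ξ ^ 3) a b c := by
  have hη3 : η ^ 3 = 1 := by linear_combination (η - 1) * hη
  simp only [orderThreeNorm, cubicNorm, map_add, map_mul, map_pow, ha, hb, hc, hξ, hτη]
  grind

/-- Polynomial expressions in `B, A, x` and a cube root `ξ` have degree at most two in `ξ`. -/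
lemma exists_aeval_eq_of_cube_eq {K : Type*} [Field K] [Algebra ℂ K] {A B x ξ : K}
    (hξ : ξ ^ 3 = B ^ 3 + A ^ 3 + 1) (r : MvPolynomial (Fin 4) ℂ) :
    ∃ a b c : MvPolynomial (Fin 3) ℂ, aeval ![B, A, x, ξ] r =
      aeval ![B, A, x] a + aeval ![B, A, x] b * ξ + aeval ![B, A, x] c * ξ ^ 2 := by
  induction r using MvPolynomial.induction_on with
  | C t => exact ⟨C t, 0, 0, by simp⟩
  | add p q hp hq =>
    obtain ⟨a, b, c, h⟩ := hp
    obtain ⟨a', b', c', h'⟩ := hq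
    refine ⟨a + a', b + b', c + c', ?_⟩
    simp only [map_add, h, h']
    ring
  | mul_X p i hp =>
    obtain ⟨a, b, c, h⟩ := hp
    rw [map_mul, h, aeval_X]
    have hv : ∀ j, aeval ![B, A, x] (X j : MvPolynomial (Fin 3) ℂ) = ![B, A, x] j := aeval_X _
    have mul_of : ∀ j : Fin 3, ![B, A, x, ξ] i = ![B, A, x] j → ∃ a' b' c' :
        MvPolynomial (Fin 3) ℂ, (aeval ![B, A, x] a + aeval ![B, A, x] b * ξ +
          aeval ![B, A, x] c * ξ ^ 2) * ![B, A, x, ξ] i =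
        aeval ![B, A, x] a' + aeval ![B, A, x] b' * ξ + aeval ![B, A, x] c' * ξ ^ 2 := by
      intro j hj
      refine ⟨a * X j, b * X j, c * X j, ?_⟩
      rw [hj]
      simp only [map_mul, hv]
      ring
    fin_cases i
    · exact mul_of 0 rfl
    · exact mul_of 1 rfl
    · exact mul_of 2 rfl
    · refine ⟨c * (X 0 ^ 3 + X 1 ^ 3 + 1), a, b, ?_⟩
      have h0 : aeval ![B, A, x] (X 0 : MvPolynomial (Fin 3) ℂ) = B := hv 0
      have h1 : aeval ![B, A, x] (X 1 : MvPolynomial (Fin 3) ℂ) = A := hv 1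
      simp only [map_mul, map_add, map_pow, map_one, h0, h1]
      change _ * ξ = _
      linear_combination aeval ![B, A, x] c * hξ

lemma not_adjoin_fermat_eq_top
    {σ : MvPolynomial (Fin 3) ℂ ≃ₐ[ℂ] MvPolynomial (Fin 3) ℂ} {τ : Fxyz ≃ₐ[ℂ] Fxyz}
    (hτ : ∀ p, τ (algebraMap _ Fxyz p) = algebraMap _ Fxyz (σ p))
    (hσ : ∀ p, σ (σ (σ p)) = p) {ω : ℂ} (hω : ω ^ 2 + ω + 1 = 0) {A B x ξ : Fxyz}
    (hξ : ξ ^ 3 = B ^ 3 + A ^ 3 + 1) (hA : τ A = A) (hB : τ B = B) (hx : τ x = x)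
    (hτξ : τ ξ = algebraMap ℂ Fxyz (ω ^ 2) * ξ) (hi : AlgebraicIndependent ℂ ![B, A, x]) :
    IntermediateField.adjoin ℂ (Set.range ![B, A, x, ξ]) ≠ ⊤ := by
  intro htop
  have hωη : (algebraMap ℂ Fxyz (ω ^ 2)) ^ 2 + algebraMap ℂ Fxyz (ω ^ 2) + 1 = 0 := by
    rw [← map_pow, ← map_add, ← map_one (algebraMap ℂ Fxyz), ← map_add,
      show (ω ^ 2) ^ 2 + ω ^ 2 + 1 = 0 by linear_combination (ω ^ 2 - ω + 1) * hω, map_zero]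
  have haev0 : aeval ![B, A, x] (X 0 : MvPolynomial (Fin 3) ℂ) = B := aeval_X _ 0
  have haev1 : aeval ![B, A, x] (X 1 : MvPolynomial (Fin 3) ℂ) = A := aeval_X _ 1
  have hfix : ∀ a : MvPolynomial (Fin 3) ℂ, τ (aeval ![B, A, x] a) = aeval ![B, A, x] a := by
    intro a
    have : (τ : Fxyz →ₐ[ℂ] Fxyz).comp (aeval ![B, A, x]) = aeval ![B, A, x] := by
      refine MvPolynomial.algHom_ext fun i ↦ ?_
      rw [AlgHom.comp_apply, aeval_X]
      fin_cases i
      · exact hB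
      · exact hA
      · exact hx
    exact DFunLike.congr_fun this a
  have hnorm : ∀ {a b c : Fxyz}, τ a = a → τ b = b → τ c = c →
      orderThreeNorm τ.toRingEquiv (a + b * ξ + c * ξ ^ 2) = cubicNorm (ξ ^ 3) a b c :=
    fun ha hb hc ↦ orderThreeNorm_eq_cubicNorm (τ := τ.toRingEquiv) hωη (τ.commutes _) hτξ ha hb hc
  have hβ : orderThreeNorm τ.toRingEquiv (ξ - B) = A ^ 3 + 1 := by
    have := hnorm (a := -B) (b := 1) (c := 0) (by rw [map_neg, hB]) (map_one τ) (map_zero τ)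
    rw [show -B + 1 * ξ + 0 * ξ ^ 2 = ξ - B by ring] at this
    rw [this, cubicNorm, hξ]
    ring
  have hA0 : A ^ 3 + 1 ≠ 0 := by
    intro h
    have h' : (X 1 ^ 3 + 1 : MvPolynomial (Fin 3) ℂ) = 0 := by
      apply hi
      simp only [map_add, map_pow, map_one, map_zero, haev1]
      exact h
    simpa using congrArg (aeval (0 : Fin 3 → ℂ)) h'
  have hu : ∀ u : MvPolynomial (Fin 3) ℂ, IsUnit u → σ.toRingEquiv u = u →
      ∃ v, orderThreeNorm σ.toRingEquiv v = u := by
    intro u hu _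
    obtain ⟨r, _, rfl⟩ := MvPolynomial.isUnit_iff_eq_C_of_isReduced.mp hu
    obtain ⟨s, rfl⟩ := IsAlgClosed.exists_pow_nat_eq r (n := 3) (by norm_num)
    have hs : σ.toRingEquiv (C s) = C s := σ.commutes s
    exact ⟨C s, by rw [orderThreeNorm, hs, hs, C_pow]; ring⟩
  obtain ⟨p, q, hp, hpq⟩ := exists_mul_orderThreeNorm_eq (σ := σ.toRingEquiv)
    (τ := τ.toRingEquiv) hτ hσ hu (ω := C ω)
    (by rw [← C_pow, ← C_1, ← C_add, ← C_add, hω, C_0]) (σ.commutes ω) hA hβ hA0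
  have hrep : ∀ m : Fxyz, ∃ n d : MvPolynomial (Fin 4) ℂ,
      aeval ![B, A, x, ξ] d ≠ 0 ∧ m * aeval ![B, A, x, ξ] d = aeval ![B, A, x, ξ] n := by
    intro m
    have hm : m ∈ IntermediateField.adjoin ℂ (Set.range ![B, A, x, ξ]) := htop ▸ trivial
    rw [IntermediateField.mem_adjoin_range_iff] at hm
    obtain ⟨n, d, rfl⟩ := hm
    by_cases hd : aeval ![B, A, x, ξ] d = 0
    · exact ⟨0, 1, by simp, by simp [hd]⟩
    · exact ⟨n, d, hd, div_mul_cancel₀ _ hd⟩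
  obtain ⟨n, d, hd, hn⟩ := hrep (algebraMap _ Fxyz p)
  obtain ⟨n', d', hd', hn'⟩ := hrep (algebraMap _ Fxyz q)
  have hp0 : algebraMap _ Fxyz p ≠ 0 := by
    rwa [Ne, map_eq_zero_iff _ (IsFractionRing.injective _ Fxyz)]
  obtain ⟨a, b, c, habc⟩ := exists_aeval_eq_of_cube_eq (x := x) hξ (n * d')
  obtain ⟨a', b', c', habc'⟩ := exists_aeval_eq_of_cube_eq (x := x) hξ (n' * d)
  have heq : (A + 1) * orderThreeNorm τ.toRingEquiv (aeval ![B, A, x, ξ] (n * d')) =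
      (A + algebraMap (MvPolynomial (Fin 3) ℂ) Fxyz (C ω)) *
        orderThreeNorm τ.toRingEquiv (aeval ![B, A, x, ξ] (n' * d)) := by
    rw [map_mul, map_mul, ← hn, ← hn']
    simp only [orderThreeNorm_mul]
    linear_combination orderThreeNorm τ.toRingEquiv (aeval ![B, A, x, ξ] d) *
      orderThreeNorm τ.toRingEquiv (aeval ![B, A, x, ξ] d') * hpq
  rw [habc, habc', hnorm (hfix a) (hfix b) (hfix c), hnorm (hfix a') (hfix b') (hfix c'),
    ← MvPolynomial.algebraMap_eq, ← IsScalarTower.algebraMap_apply, hξ] at heq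
  obtain ⟨rfl, rfl, rfl⟩ := MvPolynomial.eq_zero_of_mul_cubicNorm_fermat_eq hω
    (a := a) (b := b) (c := c) (a' := a') (b' := b') (c' := c') (by
      apply hi
      have hC : aeval ![B, A, x] (C ω : MvPolynomial (Fin 3) ℂ) = algebraMap ℂ Fxyz ω :=
        aeval_C _ ω
      simp only [map_mul, map_add, map_pow, map_one, map_cubicNorm, haev0, haev1, hC]
      exact heq)
  rw [map_mul, ← hn] at habc
  simp only [map_zero, zero_mul, add_zero] at habc
  exact mul_ne_zero (mul_ne_zero hp0 hd) hd' habc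

lemma fermat_form {K : Type*} [Field K] {w z p m s t y : K} (hw : w ^ 2 + w + 1 = 0)
    (hz : z ^ 3 = w) (hp0 : 2 * p ≠ 0) (hm : m ^ 3 = 9 / (2 * p))
    (hs : s ^ 3 = 2 * p * (t ^ 2 * y + y ^ 2 + t)) (hv : t + y + 1 ≠ 0) :
    (m * s / (t + y + 1)) ^ 3 = (z * (t + w ^ 2 * y + w) / (t + y + 1)) ^ 3 +
      (z ^ 2 * (t + w * y + w ^ 2) / (t + y + 1)) ^ 3 + 1 := by
  have hm' : m ^ 3 * (2 * p) = 9 := by rw [hm, div_mul_cancel₀ _ hp0]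
  have hz6 : (z ^ 2) ^ 3 = w ^ 2 := by rw [← hz]; ring
  have hw3 : w ^ 3 = 1 := by linear_combination (w - 1) * hw
  have key : 9 * (t ^ 2 * y + y ^ 2 + t) = w * (t + w ^ 2 * y + w) ^ 3 +
      w ^ 2 * (t + w * y + w ^ 2) ^ 3 + (t + y + 1) ^ 3 := by
    grind
  simp only [div_pow, mul_pow z, mul_pow (z ^ 2), mul_pow m, hz, hz6, hs]
  field_simp
  linear_combination (t ^ 2 * y + y ^ 2 + t) * hm' + key

lemma mem_of_fermat_coordinates {F K : Type*} [Field F] [Field K] [CharZero K] [Algebra F K]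
    {E : IntermediateField F K} {w z t y : K} (hw : w ^ 2 + w + 1 = 0) (hz0 : z ≠ 0)
    (hwE : w ∈ E) (hzE : z ∈ E) (hv : t + y + 1 ≠ 0)
    (hB : z * (t + w ^ 2 * y + w) / (t + y + 1) ∈ E)
    (hA : z ^ 2 * (t + w * y + w ^ 2) / (t + y + 1) ∈ E) : t ∈ E ∧ y ∈ E := by
  have h3 : (3 : K) ∈ E := ofNat_mem E 3
  obtain ⟨a, ha⟩ : ∃ a, a = (t + w * y + w ^ 2) / (t + y + 1) := ⟨_, rfl⟩
  obtain ⟨b, hb⟩ : ∃ b, b = (t + w ^ 2 * y + w) / (t + y + 1) := ⟨_, rfl⟩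
  have haE : a ∈ E := by
    have := div_mem hA (pow_mem hzE 2)
    rwa [mul_div_assoc, mul_div_cancel_left₀ _ (pow_ne_zero 2 hz0), ← ha] at this
  have hbE : b ∈ E := by
    have := div_mem hB hzE
    rwa [mul_div_assoc, mul_div_cancel_left₀ _ hz0, ← hb] at this
  rw [eq_div_iff hv] at ha hb
  have hw3 : w ^ 3 = 1 := by linear_combination (w - 1) * hw
  have hc : (t + y + 1) * (1 + w * a + w ^ 2 * b) = 3 := by grind
  have hcE : 1 + w * a + w ^ 2 * b ∈ E :=
    add_mem (add_mem (one_mem E) (mul_mem hwE haE)) (mul_mem (pow_mem hwE 2) hbE)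
  have hc0 : 1 + w * a + w ^ 2 * b ≠ 0 := by
    intro h
    rw [h, mul_zero] at hc
    exact three_ne_zero hc.symm
  have hvE : t + y + 1 ∈ E := by
    rw [eq_div_of_mul_eq hc0 hc]
    exact div_mem h3 hcE
  constructor
  · have : t = (t + y + 1) * (1 + a + b) / 3 := by
      rw [eq_div_iff three_ne_zero]
      linear_combination -ha - hb - (y + 1) * hw
    rw [this]
    exact div_mem (mul_mem hvE (add_mem (add_mem (one_mem E) haE) hbE)) h3
  · have : y = (t + y + 1) * (1 + w ^ 2 * a + w * b) / 3 := by
      rw [eq_div_iff three_ne_zero]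
      grind
    rw [this]
    exact div_mem (mul_mem hvE (add_mem (add_mem (one_mem E) (mul_mem (pow_mem hwE 2) haE))
      (mul_mem hwE hbE))) h3

lemma exists_weighted_coordinates {K : Type*} [Field K] [CharZero K] {u P Q R p : K}
    (hu : u ≠ 0) (hQ : Q ≠ 0) (hp : p ^ 3 = -2) (h : P ^ 3 * Q + Q ^ 3 + R ^ 2 = u ^ 18) :
    ∃ s t y : K, y ≠ 0 ∧ P = u ^ 4 * s ∧ Q = p ^ 2 * u ^ 6 * y ∧ R = u ^ 9 * (1 + 2 * t * y) ∧
      s ^ 3 = 2 * p * (t ^ 2 * y + y ^ 2 + t) := by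
  have hp0 : p ≠ 0 := by
    rintro rfl
    norm_num at hp
  obtain ⟨s, rfl⟩ : ∃ s, P = u ^ 4 * s := ⟨P / u ^ 4, by field_simp⟩
  obtain ⟨y, rfl⟩ : ∃ y, Q = p ^ 2 * u ^ 6 * y := ⟨Q / (p ^ 2 * u ^ 6), by field_simp⟩
  have hy : y ≠ 0 := right_ne_zero_of_mul hQ
  obtain ⟨t, rfl⟩ : ∃ t, R = u ^ 9 * (1 + 2 * t * y) :=
    ⟨(R / u ^ 9 - 1) / (2 * y), by field_simp; ring⟩
  refine ⟨s, t, y, hy, rfl, rfl, rfl, ?_⟩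
  have hne : u ^ 18 * p ^ 2 * y ≠ 0 := by positivity
  apply mul_left_cancel₀ hne
  linear_combination h + u ^ 18 * (-2 * y * (t ^ 2 * y + y ^ 2 + t) - y ^ 3 * (p ^ 3 - 2)) * hp

/-- The surface `P³Q + Q³ + R² = u¹⁸` over `ℂ(u)` admits no generic parametrization which is
invariant under multiplication of `u` by a cube root of unity. -/
lemma false_of_invariant_parametrization
    {σ : MvPolynomial (Fin 3) ℂ ≃ₐ[ℂ] MvPolynomial (Fin 3) ℂ} {τ : Fxyz ≃ₐ[ℂ] Fxyz}
    (hτ : ∀ p, τ (algebraMap _ Fxyz p) = algebraMap _ Fxyz (σ p))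
    (hσ : ∀ p, σ (σ (σ p)) = p) {ω : ℂ} (hω : ω ^ 2 + ω + 1 = 0) {u P Q R : Fxyz} (hu : u ≠ 0)
    (hQ : Q ≠ 0) (h : P ^ 3 * Q + Q ^ 3 + R ^ 2 = u ^ 18)
    (hτu : τ u = algebraMap ℂ Fxyz ω * u) (hτP : τ P = P) (hτQ : τ Q = Q) (hτR : τ R = R)
    (hgen : ∀ E : IntermediateField ℂ Fxyz, u ∈ E → P ∈ E → Q ∈ E → R ∈ E → E = ⊤) : False := by
  obtain ⟨p₀, hp₀⟩ := IsAlgClosed.exists_pow_nat_eq (-2 : ℂ) (n := 3) (by norm_num)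
  obtain ⟨ζ, hζ⟩ := IsAlgClosed.exists_pow_nat_eq ω (n := 3) (by norm_num)
  obtain ⟨μ, hμ⟩ := IsAlgClosed.exists_pow_nat_eq (9 / (2 * p₀)) (n := 3) (by norm_num)
  have hp₀0 : p₀ ≠ 0 := by
    rintro rfl
    norm_num at hp₀
  have hω0 : ω ≠ 0 := by
    rintro rfl
    norm_num at hω
  have hζ0 : ζ ≠ 0 := by
    rintro rfl
    exact hω0 (by rw [← hζ]; norm_num)
  have hμ0 : μ ≠ 0 := by
    rintro rfl
    rw [zero_pow three_ne_zero] at hμ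
    exact div_ne_zero (by norm_num) (mul_ne_zero two_ne_zero hp₀0) hμ.symm
  have hinj := (algebraMap ℂ Fxyz).injective
  obtain ⟨w, hw⟩ : ∃ w, w = algebraMap ℂ Fxyz ω := ⟨_, rfl⟩
  obtain ⟨p, hp⟩ : ∃ p, p = algebraMap ℂ Fxyz p₀ := ⟨_, rfl⟩
  obtain ⟨z, hz⟩ : ∃ z, z = algebraMap ℂ Fxyz ζ := ⟨_, rfl⟩
  obtain ⟨m, hm⟩ : ∃ m, m = algebraMap ℂ Fxyz μ := ⟨_, rfl⟩
  have hτw : τ w = w := hw ▸ τ.commutes ω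
  have hτp : τ p = p := hp ▸ τ.commutes p₀
  have hτz : τ z = z := hz ▸ τ.commutes ζ
  have hτm : τ m = m := hm ▸ τ.commutes μ
  have hwE : ∀ E : IntermediateField ℂ Fxyz, w ∈ E := fun E ↦ hw ▸ E.algebraMap_mem ω
  have hpE : ∀ E : IntermediateField ℂ Fxyz, p ∈ E := fun E ↦ hp ▸ E.algebraMap_mem p₀
  have hzE : ∀ E : IntermediateField ℂ Fxyz, z ∈ E := fun E ↦ hz ▸ E.algebraMap_mem ζ
  have hmE : ∀ E : IntermediateField ℂ Fxyz, m ∈ E := fun E ↦ hm ▸ E.algebraMap_mem μ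
  have hw2 : w ^ 2 + w + 1 = 0 := by
    rw [hw, ← map_pow, ← map_add, ← map_one (algebraMap ℂ Fxyz), ← map_add, hω, map_zero]
  have hw3 : w ^ 3 = 1 := by linear_combination (w - 1) * hw2
  have hp3 : p ^ 3 = -2 := by rw [hp, ← map_pow, hp₀, map_neg, map_ofNat]
  have hz3 : z ^ 3 = w := by rw [hz, ← map_pow, hζ, hw]
  have hm3 : m ^ 3 = 9 / (2 * p) := by
    rw [hm, hp, ← map_pow, hμ, map_div₀, map_mul, map_ofNat, map_ofNat]
  have hp0 : p ≠ 0 := hp ▸ (map_ne_zero_iff _ hinj).mpr hp₀0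
  have hz0 : z ≠ 0 := hz ▸ (map_ne_zero_iff _ hinj).mpr hζ0
  have hm0 : m ≠ 0 := hm ▸ (map_ne_zero_iff _ hinj).mpr hμ0
  rw [← hw] at hτu
  obtain ⟨s, t, y, hy, rfl, rfl, rfl, hs⟩ := exists_weighted_coordinates hu hQ hp3 h
  have hτs : τ s = w ^ 2 * s := by
    rw [map_mul, map_pow, hτu] at hτP
    apply mul_left_cancel₀ (pow_ne_zero 4 hu)
    linear_combination w ^ 2 * hτP - u ^ 4 * τ s * (w ^ 3 + 1) * hw3
  have hτy : τ y = y := by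
    rw [map_mul, map_mul, map_pow, map_pow, hτu, hτp] at hτQ
    apply mul_left_cancel₀ (mul_ne_zero (pow_ne_zero 2 hp0) (pow_ne_zero 6 hu))
    linear_combination hτQ - p ^ 2 * u ^ 6 * τ y * (w ^ 3 + 1) * hw3
  have hτt : τ t = t := by
    simp only [map_mul, map_pow, map_add, map_one, map_ofNat, hτu, hτy] at hτR
    apply mul_left_cancel₀ (mul_ne_zero (mul_ne_zero (pow_ne_zero 9 hu) two_ne_zero) hy)
    linear_combination hτR - u ^ 9 * (1 + 2 * τ t * y) * (w ^ 6 + w ^ 3 + 1) * hw3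
  have hgen' : ∀ E : IntermediateField ℂ Fxyz, u ∈ E → s ∈ E → t ∈ E → y ∈ E → E = ⊤ := by
    intro E hu hs ht hy
    refine hgen E hu (mul_mem (pow_mem hu 4) hs)
      (mul_mem (mul_mem (pow_mem (hpE E) 2) (pow_mem hu 6)) hy) (mul_mem (pow_mem hu 9) ?_)
    exact add_mem (one_mem E) (mul_mem (mul_mem (ofNat_mem E 2) ht) hy)
  have hsE : ∀ E : IntermediateField ℂ Fxyz, t ∈ E → y ∈ E → s ^ 3 ∈ E := by
    intro E ht hy
    rw [hs]
    exact mul_mem (mul_mem (ofNat_mem E 2) (hpE E))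
      (add_mem (add_mem (mul_mem (pow_mem ht 2) hy) (pow_mem hy 2)) ht)
  have hyt : AlgebraicIndependent ℂ ![y, t, u] :=
    algebraicIndependent_of_forall_eq_top _ fun E hE hroot ↦
      hgen' E (hE 2) (hroot s 3 (by norm_num) (hsE E (hE 1) (hE 0))) (hE 1) (hE 0)
  have haev0 : aeval ![y, t, u] (X 0 : MvPolynomial (Fin 3) ℂ) = y := aeval_X _ 0
  have haev1 : aeval ![y, t, u] (X 1 : MvPolynomial (Fin 3) ℂ) = t := aeval_X _ 1
  have hv : t + y + 1 ≠ 0 := by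
    intro h0
    have h' : (X 1 + X 0 + 1 : MvPolynomial (Fin 3) ℂ) = 0 := by
      apply hyt
      simpa only [map_add, map_one, map_zero, haev0, haev1] using h0
    simpa using congrArg (aeval (0 : Fin 3 → ℂ)) h'
  have hs0 : s ≠ 0 := by
    rintro rfl
    have h' : (X 1 ^ 2 * X 0 + X 0 ^ 2 + X 1 : MvPolynomial (Fin 3) ℂ) = 0 := by
      apply hyt
      simp only [map_add, map_mul, map_pow, map_zero, haev0, haev1]
      rw [zero_pow three_ne_zero] at hs
      exact (mul_eq_zero.mp hs.symm).resolve_left (mul_ne_zero two_ne_zero hp0)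
    simpa using congrArg (aeval (![1, 0, 0] : Fin 3 → ℂ)) h'
  have hξ0 : m * s / (t + y + 1) ≠ 0 := div_ne_zero (mul_ne_zero hm0 hs0) hv
  have hξ := fermat_form hw2 hz3 (mul_ne_zero two_ne_zero hp0) hm3 hs hv
  have hgenξ : ∀ E : IntermediateField ℂ Fxyz, z * (t + w ^ 2 * y + w) / (t + y + 1) ∈ E →
      z ^ 2 * (t + w * y + w ^ 2) / (t + y + 1) ∈ E → m * s / (t + y + 1) * u ∈ E →
      m * s / (t + y + 1) ∈ E → E = ⊤ := by
    intro E hB hA hx hξE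
    obtain ⟨ht, hy⟩ := mem_of_fermat_coordinates hw2 hz0 (hwE E) (hzE E) hv hB hA
    have huE : u ∈ E := by
      have := div_mem hx hξE
      rwa [mul_div_cancel_left₀ _ hξ0] at this
    have hsE : s ∈ E := by
      have := div_mem (mul_mem hξE (add_mem (add_mem ht hy) (one_mem E))) (hmE E)
      rwa [div_mul_cancel₀ _ hv, mul_div_cancel_left₀ _ hm0] at this
    exact hgen' E huE hsE ht hy
  refine not_adjoin_fermat_eq_top hτ hσ hω (A := z ^ 2 * (t + w * y + w ^ 2) / (t + y + 1))
    (B := z * (t + w ^ 2 * y + w) / (t + y + 1)) (x := m * s / (t + y + 1) * u)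
    (ξ := m * s / (t + y + 1)) hξ ?_ ?_ ?_ ?_ ?_ ?_
  · simp only [map_div₀, map_mul, map_add, map_pow, map_one, hτz, hτw, hτt, hτy]
  · simp only [map_div₀, map_mul, map_add, map_pow, map_one, hτz, hτw, hτt, hτy]
  · simp only [map_div₀, map_mul, map_add, map_one, hτm, hτs, hτt, hτy, hτu]
    linear_combination m * s / (t + y + 1) * u * hw3
  · rw [map_pow, ← hw]
    simp only [map_div₀, map_mul, map_add, map_one, hτm, hτs, hτt, hτy]
    ring
  · refine algebraicIndependent_of_forall_eq_top _ fun E hE hroot ↦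
      hgenξ E (hE 0) (hE 1) (hE 2) (hroot _ 3 (by norm_num) ?_)
    rw [hξ]
    exact add_mem (add_mem (pow_mem (hE 0) 3) (pow_mem (hE 1) 3)) (one_mem E)
  · have hmem : ∀ i, ![z * (t + w ^ 2 * y + w) / (t + y + 1),
        z ^ 2 * (t + w * y + w ^ 2) / (t + y + 1), m * s / (t + y + 1) * u,
        m * s / (t + y + 1)] i ∈ IntermediateField.adjoin ℂ (Set.range
          ![z * (t + w ^ 2 * y + w) / (t + y + 1), z ^ 2 * (t + w * y + w ^ 2) / (t + y + 1),
            m * s / (t + y + 1) * u, m * s / (t + y + 1)]) :=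
      fun i ↦ IntermediateField.subset_adjoin ℂ _ ⟨i, rfl⟩
    exact hgenξ _ (hmem 0) (hmem 1) (hmem 2) (hmem 3)

theorem e7_not_rational :
    ¬ ∃ g h : Fxyz,
      IntermediateField.adjoin ℂ {Vx ^ 3 * Vy + Vy ^ 3 + Vz ^ 2, g, h} =
        (⊤ : IntermediateField ℂ Fxyz) := by
  rintro ⟨g, h, hgh⟩
  obtain ⟨ω, hω⟩ : ∃ ω : ℂ, ω ^ 2 + ω + 1 = 0 := by
    obtain ⟨r, hr⟩ := IsAlgClosed.exists_pow_nat_eq (-3 : ℂ) (n := 2) (by norm_num)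
    exact ⟨(r - 1) / 2, by linear_combination hr / 4⟩
  have hω3 : ω ^ 3 = 1 := by linear_combination (ω - 1) * hω
  obtain ⟨σ, τ, hτ, hσ, hx, hy, hz⟩ := exists_automorphism_of_cube_eq_one hω3
  obtain ⟨φ, hφf, hφg, hφh⟩ :=
    exists_algHom_of_adjoin_eq_top hgh (algebraicIndependent_pow_variable (n := 18) (by norm_num))
  have hcomp : (τ : Fxyz →ₐ[ℂ] Fxyz).comp φ = φ := by
    apply algHom_ext_of_adjoin_eq_top hgh
    · rw [AlgHom.comp_apply, hφf]
      change τ (Vx ^ 18) = _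
      rw [map_pow, hx, mul_pow, ← map_pow, show ω ^ 18 = 1 by rw [pow_mul ω 3 6, hω3, one_pow],
        map_one, one_mul]
    · rw [AlgHom.comp_apply, hφg]
      exact hy
    · rw [AlgHom.comp_apply, hφh]
      exact hz
  have hfix : ∀ a, τ (φ a) = φ a := fun a ↦ DFunLike.congr_fun hcomp a
  have hinj := IsFractionRing.injective (MvPolynomial (Fin 3) ℂ) Fxyz
  have hVx : Vx ≠ 0 := (map_ne_zero_iff _ hinj).mpr (X_ne_zero 0)
  have hVy : Vy ≠ 0 := (map_ne_zero_iff _ hinj).mpr (X_ne_zero 1)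
  refine false_of_invariant_parametrization hτ hσ hω hVx
    ((map_ne_zero_iff φ φ.toRingHom.injective).mpr hVy) (P := φ Vx) (R := φ Vz)
    (by rw [← hφf]; simp only [map_add, map_mul, map_pow]) hx (hfix _) (hfix _) (hfix _) ?_
  intro E huE hP hQ hR
  have hcomap : E.comap φ = ⊤ := by
    rw [eq_top_iff, ← adjoin_variables_eq_top, IntermediateField.adjoin_le_iff]
    rintro a (rfl | rfl | rfl)
    · exact hP
    · exact hQ
    · exact hR
  have hmem : ∀ a, φ a ∈ E := fun a ↦ (hcomap ▸ trivial : a ∈ E.comap φ)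
  rw [eq_top_iff, ← adjoin_variables_eq_top, IntermediateField.adjoin_le_iff]
  rintro a (rfl | rfl | rfl)
  · exact huE
  · exact hφg ▸ hmem g
  · exact hφh ▸ hmem h

end
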